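/- Let E be a real Banach space and I ∈ C¹(E, ℝ) be even with I(0) = 0 and satisfying the Palais–Smale condition at every level. Suppose (1) there exist a closed subspace Ẽ ⊂ E of codimension j and a constant b such that I(u) ≥ b for all u ∈ Ẽ, and (2) there exists a closed symmetric set A ⊂ E∖{0} with Krasnoselskii genus γ(A) = m > j and sup_A I < 0. Then I possesses at least m − j distinct pairs of nontrivial critical points. -/

import Mathlib

open Filter
open scoped Topology

noncomputable section

/-- The Krasnoselskii genus of `A` is at most `k`: there is an odd continuous map
from `A` into `ℝᵏ ∖ {0}`. -/
def GenusLE {E : Type*} [NormedAddCommGroup E] (A : Set E) (k : ℕ) : Prop :=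
  ∃ g : E → EuclideanSpace ℝ (Fin k), ContinuousOn g A ∧
    (∀ u ∈ A, g (-u) = - g u) ∧ ∀ u ∈ A, g u ≠ 0

/-- The Krasnoselskii genus of `A` equals `m`: `m` is the least integer `k` such that
there is an odd continuous map from `A` into `ℝᵏ ∖ {0}`. -/
def GenusEq {E : Type*} [NormedAddCommGroup E] (A : Set E) (m : ℕ) : Prop :=
  GenusLE A m ∧ ∀ k : ℕ, GenusLE A k → m ≤ k

/-- Continuous selection with a prescribed parity on a symmetric open set. -/
lemma sel_parity {E F : Type*} [NormedAddCommGroup E]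
    [NormedAddCommGroup F] [NormedSpace ℝ F] (Ω : Set E)
    (hsym : ∀ x ∈ Ω, -x ∈ Ω) (S : E → Set F) (hS : ∀ x ∈ Ω, Convex ℝ (S x))
    (hloc : ∀ x ∈ Ω, ∃ c, ∀ᶠ y in 𝓝 x, c ∈ S y) (e : ℝ) (he : e * e = 1)
    (hpar : ∀ x ∈ Ω, ∀ w ∈ S x, e • w ∈ S (-x)) :
    ∃ g : E → F, ContinuousOn g Ω ∧ (∀ x ∈ Ω, g x ∈ S x) ∧ ∀ x, g (-x) = e • g x := by
  classical
  obtain ⟨f, hf⟩ := exists_continuous_forall_mem_convex_of_local_const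
    (X := Ω) (t := fun x => S x) (fun x => hS x x.2) (fun x => by
      obtain ⟨c, hc⟩ := hloc x x.2
      exact ⟨c, continuous_subtype_val.continuousAt.eventually hc⟩)
  let F₀ : E → F := fun x => if h : x ∈ Ω then f ⟨x, h⟩ else 0
  have hF₀ : ContinuousOn F₀ Ω := by
    rw [continuousOn_iff_continuous_domRestrict]
    convert f.continuous using 1
    ext x
    simp [F₀, x.2]
  have hF₀S : ∀ x ∈ Ω, F₀ x ∈ S x := fun x hx => by
    simp only [F₀, hx, dif_pos]; exact hf ⟨x, hx⟩
  refine ⟨fun x => (1/2 : ℝ) • F₀ x + (1/2 : ℝ) • (e • F₀ (-x)), ?_, ?_, ?_⟩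
  · have : ContinuousOn (fun x => F₀ (-x)) Ω :=
      hF₀.comp continuous_neg.continuousOn (fun x hx => hsym x hx)
    exact (hF₀.const_smul _).add ((this.const_smul _).const_smul _)
  · intro x hx
    refine hS x hx (hF₀S x hx) ?_ (by norm_num) (by norm_num) (by norm_num)
    have := hpar (-x) (hsym x hx) _ (hF₀S _ (hsym x hx))
    rwa [neg_neg] at this
  · intro x
    simp only [neg_neg, smul_add]
    rw [smul_comm e (1/2 : ℝ) (e • F₀ (-x)), smul_smul e e, he, one_smul,
      smul_comm e (1/2 : ℝ) (F₀ x), add_comm]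

set_option maxHeartbeats 2000000 in
/-- One-step descent map. -/
lemma step_map {E : Type*} [NormedAddCommGroup E] [NormedSpace ℝ E]
    (I : E → ℝ) (I' : E → (E →L[ℝ] ℝ))
    (hderiv : ∀ u : E, HasFDerivAt I (I' u) u)
    (hcont : Continuous I')
    (heven : ∀ u : E, I (-u) = I u) (hodd : ∀ u, I' (-u) = - I' u)
    (ρ : ℝ) (hρ : 0 < ρ) :
    ∃ T : E → E, Continuous T ∧ (∀ u, T (-u) = - T u) ∧ (∀ u, ‖T u - u‖ ≤ ρ) ∧
      (∀ u, ∀ θ : ℝ, 0 ≤ θ → θ ≤ 1 →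
        I (u + θ • (T u - u)) ≤ I u - θ * (1/4 * ‖I' u‖ * ‖T u - u‖)) ∧
      ∀ u, T u = u → I' u = 0 := by
  classical
  let Ω : Set E := {u | I' u ≠ 0}
  have hO : IsOpen Ω := isOpen_ne_fun hcont continuous_const
  have hsym : ∀ x ∈ Ω, -x ∈ Ω := fun x hx => by
    simpa [Ω, hodd] using hx
  have hnn : Continuous fun u => ‖I' u‖ := hcont.norm
  obtain ⟨V, hVc, hVS, hVodd⟩ := sel_parity (F := E) Ω hsym
    (fun u => Metric.closedBall 0 1 ∩ {w | 1/2 * ‖I' u‖ < I' u w})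
    (fun u hu => (convex_closedBall 0 1).inter
      (convex_halfSpace_gt (I' u).isLinear _)) (by
      intro u hu
      have hpos : 0 < ‖I' u‖ := norm_pos_iff.2 hu
      obtain ⟨w, hw1, hw2⟩ := (I' u).exists_lt_apply_of_lt_opNorm
        (show 1/2 * ‖I' u‖ < ‖I' u‖ by linarith)
      obtain ⟨w', hw1', hw2'⟩ : ∃ w', ‖w'‖ < 1 ∧ 1/2 * ‖I' u‖ < I' u w' := by
        rw [Real.norm_eq_abs] at hw2
        rcases le_total 0 (I' u w) with h | h
        · exact ⟨w, hw1, by rwa [abs_of_nonneg h] at hw2⟩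
        · exact ⟨-w, by simpa using hw1, by rw [abs_of_nonpos h] at hw2; simpa using hw2⟩
      refine ⟨w', ?_⟩
      have : ∀ᶠ y in 𝓝 u, 1/2 * ‖I' y‖ < I' y w' :=
        (continuous_const.mul hnn).continuousAt.eventually_lt
          (hcont.clm_apply continuous_const).continuousAt hw2'
      filter_upwards [this] with y hy
      exact ⟨by simpa using hw1'.le, hy⟩) (-1) (by norm_num) (by
      rintro u hu w ⟨hw1, hw2⟩
      refine ⟨by simpa using hw1, ?_⟩
      simpa [hodd] using hw2)
  have hV1 : ∀ u ∈ Ω, ‖V u‖ ≤ 1 := fun u hu => by simpa using (hVS u hu).1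
  have hV2 : ∀ u ∈ Ω, 1/2 * ‖I' u‖ < I' u (V u) := fun u hu => (hVS u hu).2
  obtain ⟨t, htc, htS, hteven⟩ := sel_parity (F := ℝ) Ω hsym
    (fun u => {s | 0 < s ∧ s ≤ ρ ∧ s ≤ ‖I' u‖ ∧ ∀ θ, 0 ≤ θ → θ ≤ s →
      I (u - θ • V u) ≤ I u - θ * (1/4 * ‖I' u‖)})
    (by
      intro u hu
      apply Set.OrdConnected.convex
      refine ⟨?_⟩
      rintro x ⟨hx, -⟩ y ⟨hy, hy2, hy3, hy4⟩ z ⟨hz1, hz2⟩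
      exact ⟨hx.trans_le hz1, hz2.trans hy2, hz2.trans hy3,
        fun θ h0 h1 => hy4 θ h0 (h1.trans hz2)⟩)
    (by
      intro u hu
      have hpos : 0 < ‖I' u‖ := norm_pos_iff.2 hu
      have hVat : ContinuousAt V u := hVc.continuousAt (hO.mem_nhds hu)
      -- joint continuity
      have hj : ∀ᶠ p : E × E in 𝓝 (u, u), 1/4 * ‖I' p.2‖ < I' p.1 (V p.2) := by
        have c1 : ContinuousAt (fun p : E × E => 1/4 * ‖I' p.2‖) (u, u) :=
          (continuous_const.mul (hnn.comp continuous_snd)).continuousAt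
        have c2 : ContinuousAt (fun p : E × E => I' p.1 (V p.2)) (u, u) :=
          (hcont.comp continuous_fst).continuousAt.clm_apply
            (ContinuousAt.comp (f := fun p : E × E => p.2) (g := V) hVat continuous_snd.continuousAt)
        refine c1.eventually_lt c2 ?_
        have := hV2 u hu
        simp only
        linarith
      rw [nhds_prod_eq, Metric.nhds_basis_ball.prod_self.eventually_iff] at hj
      obtain ⟨r, hr, hrj⟩ := hj
      refine ⟨min (min (r/2) ρ) (‖I' u‖/2), ?_⟩
      have e1 : ∀ᶠ y in 𝓝 u, ‖I' u‖/2 < ‖I' y‖ :=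
        continuous_const.continuousAt.eventually_lt hnn.continuousAt (by linarith)
      filter_upwards [e1, Metric.ball_mem_nhds u (half_pos hr), hO.mem_nhds hu] with y h1 h2 h3
      refine ⟨by positivity, (min_le_left _ _).trans (min_le_right _ _),
        (min_le_right _ _).trans h1.le, ?_⟩
      intro θ h0 hθ
      have hθr : θ ≤ r/2 := hθ.trans ((min_le_left _ _).trans (min_le_left _ _))
      obtain ⟨z, hz, hzeq⟩ := domain_mvt (f := I) (s := Set.univ) (x := y) (y := y - θ • V y)
        (f' := I') (fun x _ => (hderiv x).hasFDerivWithinAt) convex_univ trivial trivial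
      have hyr : y ∈ Metric.ball u r := Metric.ball_subset_ball (by linarith) h2
      have hzr : z ∈ Metric.ball u r := by
        refine (convex_ball u r).segment_subset hyr ?_ hz
        rw [Metric.mem_ball, dist_eq_norm] at h2 ⊢
        have : ‖θ • V y‖ ≤ r/2 := by
          rw [norm_smul, Real.norm_of_nonneg h0]
          nlinarith [hV1 y h3, norm_nonneg (V y)]
        calc ‖y - θ • V y - u‖ = ‖(y - u) - θ • V y‖ := by congr 1; abel
          _ ≤ ‖y - u‖ + ‖θ • V y‖ := norm_sub_le _ _
          _ < r := by linarith
      have hk : 1/4 * ‖I' y‖ < I' z (V y) := hrj (show (z, y) ∈ _ from ⟨hzr, hyr⟩)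
      have : I' z (y - θ • V y - y) = - (θ * I' z (V y)) := by
        rw [show y - θ • V y - y = -(θ • V y) by abel, map_neg, map_smul, smul_eq_mul]
      rw [this] at hzeq
      nlinarith)
    1 (by norm_num) (by
      rintro u hu s ⟨h1, h2, h3, h4⟩
      rw [one_smul]
      refine ⟨h1, h2, by rwa [hodd, norm_neg], fun θ h0 hs => ?_⟩
      have := h4 θ h0 hs
      rw [hVodd, heven, hodd, norm_neg]
      rwa [show -u - θ • (-1 : ℝ) • V u = -(u - θ • V u) by
        rw [neg_one_smul, smul_neg]; abel, heven])
  have hTu : ∀ u ∈ Ω, u - t u • V u - u = - (t u • V u) := fun u _ => by abel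
  refine ⟨fun u => if u ∈ Ω then u - t u • V u else u, ?_, ?_, ?_, ?_, ?_⟩
  · rw [continuous_iff_continuousAt]
    intro u
    by_cases hu : u ∈ Ω
    · have : ContinuousAt (fun u => u - t u • V u) u :=
        continuousAt_id.sub ((htc.continuousAt (hO.mem_nhds hu)).smul
          (hVc.continuousAt (hO.mem_nhds hu)))
      refine this.congr ?_
      filter_upwards [hO.mem_nhds hu] with y hy
      simp [hy]
    · have hz : I' u = 0 := by simpa [Ω] using hu
      rw [ContinuousAt, if_neg hu]
      rw [tendsto_iff_norm_sub_tendsto_zero]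
      have hb : Tendsto (fun y => ‖y - u‖ + ‖I' y‖) (𝓝 u) (𝓝 0) := by
        have : Continuous fun y => ‖y - u‖ + ‖I' y‖ := by fun_prop
        have h := this.tendsto u
        simpa [hz] using h
      refine squeeze_zero (fun _ => norm_nonneg _) (fun y => ?_) hb
      by_cases hy : y ∈ Ω
      · rw [if_pos hy]
        obtain ⟨h1, h2, h3, h4⟩ := htS y hy
        have : ‖t y • V y‖ ≤ ‖I' y‖ := by
          rw [norm_smul, Real.norm_of_nonneg h1.le]
          nlinarith [hV1 y hy, norm_nonneg (V y)]
        calc ‖y - t y • V y - u‖ = ‖(y - u) - t y • V y‖ := by congr 1; abel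
          _ ≤ ‖y - u‖ + ‖t y • V y‖ := norm_sub_le _ _
          _ ≤ _ := by linarith
      · rw [if_neg hy]; linarith [norm_nonneg (I' y)]
  · intro u
    by_cases hu : u ∈ Ω
    · simp only [hu, hsym u hu, if_true, hteven, hVodd]
      simp only [one_smul, neg_one_smul, smul_neg]; abel
    · have : -u ∉ Ω := fun h => hu (by simpa using hsym _ h)
      simp [hu, this]
  · intro u
    by_cases hu : u ∈ Ω
    · obtain ⟨h1, h2, h3, h4⟩ := htS u hu
      simp only [hu, if_true]
      rw [hTu u hu, norm_neg, norm_smul, Real.norm_of_nonneg h1.le]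
      nlinarith [hV1 u hu, norm_nonneg (V u)]
    · simp [hu, hρ.le]
  · intro u θ h0 h1'
    by_cases hu : u ∈ Ω
    · obtain ⟨h1, h2, h3, h4⟩ := htS u hu
      simp only [hu, if_true]
      rw [hTu u hu, norm_neg, norm_smul, Real.norm_of_nonneg h1.le]
      have := h4 (θ * t u) (by positivity) (by nlinarith)
      rw [show u + θ • -(t u • V u) = u - (θ * t u) • V u by
        rw [smul_neg, smul_smul]; abel]
      refine this.trans ?_
      have h5 : θ * t u * (1/4 * ‖I' u‖) * ‖V u‖ ≤ θ * t u * (1/4 * ‖I' u‖) * 1 :=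
        mul_le_mul_of_nonneg_left (hV1 u hu) (by positivity)
      nlinarith
    · simp [hu]
  · intro u h
    by_contra hu
    obtain ⟨h1, h2, h3, h4⟩ := htS u hu
    have hu' : u ∈ Ω := hu
    simp only [hu', if_true] at h
    have h5 : t u • V u = 0 := by
      have := hTu u hu
      rw [h, sub_self] at this
      simpa using this.symm
    have h6 : V u = 0 := (smul_eq_zero.1 h5).resolve_left h1.ne'
    have := hV2 u hu
    rw [h6, map_zero] at this
    have := norm_nonneg (I' u)
    linarith

/-- Interpolated iteration of a map. -/
def interpIter {E : Type*} [NormedAddCommGroup E] [NormedSpace ℝ E] (T : E → E) :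
    ℕ → ℝ → E → E
  | 0, _, u => u
  | n + 1, s, u => interpIter T n s u +
      (max 0 (min 1 (s - n))) • (T (interpIter T n s u) - interpIter T n s u)

lemma iterate_odd {E : Type*} [NormedAddCommGroup E] (T : E → E)
    (hodd : ∀ u, T (-u) = - T u) (n : ℕ) (u : E) : T^[n] (-u) = - T^[n] u := by
  induction n with
  | zero => rfl
  | succ n ih => rw [Function.iterate_succ_apply', Function.iterate_succ_apply', ih, hodd]

lemma reach_map {E : Type*} [NormedAddCommGroup E] [NormedSpace ℝ E]
    (I : E → ℝ) (hI : Continuous I) (heven : ∀ u : E, I (-u) = I u)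
    (T : E → E) (hT : Continuous T) (hodd : ∀ u, T (-u) = - T u)
    (hdec : ∀ u, ∀ θ : ℝ, 0 ≤ θ → θ ≤ 1 → I (u + θ • (T u - u)) ≤ I u) (b : ℝ) :
    ∃ h : E → E, ContinuousOn h {x | ∃ n, I (T^[n] x) < b} ∧
      (∀ x, h (-x) = - h x) ∧ ∀ x ∈ {x | ∃ n, I (T^[n] x) < b}, I (h x) < b := by
  set P : Set E := {x | ∃ n, I (T^[n] x) < b} with hP
  have hPo : IsOpen P := by
    rw [hP, Set.ofPred_exists]
    exact isOpen_iUnion fun n => isOpen_lt (hI.comp (hT.iterate n)) continuous_const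
  have hcl0 : ∀ x : ℝ, 0 ≤ max 0 (min 1 x) := fun x => le_max_left _ _
  have hcl1 : ∀ x : ℝ, max 0 (min 1 x) ≤ 1 := fun x => max_le zero_le_one (min_le_left _ _)
  have hGc : ∀ n, Continuous fun p : ℝ × E => interpIter T n p.1 p.2 := by
    intro n
    induction n with
    | zero => exact continuous_snd
    | succ n ih =>
      simp only [interpIter]
      have := hT.comp ih
      simp only [Function.comp_def] at this
      fun_prop
  have hGodd : ∀ n s u, interpIter T n s (-u) = - interpIter T n s u := by
    intro n s u
    induction n with
    | zero => rfl
    | succ n ih =>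
      simp only [interpIter, ih, hodd]
      rw [neg_add, ← smul_neg]
      congr 2
      abel
  have hGdec : ∀ n k s u, n ≤ k → I (interpIter T k s u) ≤ I (interpIter T n s u) := by
    intro n k s u hnk
    induction k, hnk using Nat.le_induction with
    | base => exact le_rfl
    | succ k _ ih => exact (hdec _ _ (hcl0 _) (hcl1 _)).trans ih
  have hGconst : ∀ (n k : ℕ) (s : ℝ) u, s ≤ n → n ≤ k → interpIter T k s u = interpIter T n s u := by
    intro n k s u hs hnk
    induction k, hnk using Nat.le_induction with
    | base => rfl
    | succ k hk ih =>
      have : (n : ℝ) ≤ k := by exact_mod_cast hk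
      have h0 : max 0 (min 1 (s - k)) = 0 := max_eq_left ((min_le_right _ _).trans (by linarith))
      simp only [interpIter, h0, zero_smul, add_zero, ih]
  have hGiter : ∀ (n : ℕ) (s : ℝ) u, (n : ℝ) ≤ s → interpIter T n s u = T^[n] u := by
    intro n s u
    induction n with
    | zero => intro _; rfl
    | succ n ih =>
      intro h
      push_cast at h
      have h1 : max 0 (min 1 (s - n)) = 1 := by
        rw [min_eq_left (by linarith)]; exact max_eq_right zero_le_one
      simp only [interpIter, h1, one_smul]
      rw [ih (by linarith), Function.iterate_succ_apply']
      abel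
  obtain ⟨τ, hτc, hτS, hτe⟩ := sel_parity (F := ℝ) P
    (fun x ⟨n, hn⟩ => ⟨n, by rwa [iterate_odd T hodd, heven]⟩)
    (fun x => {s | ∃ n : ℕ, (n : ℝ) ≤ s ∧ I (T^[n] x) < b})
    (by
      intro x _
      apply Set.OrdConnected.convex
      refine ⟨?_⟩
      rintro s ⟨n, hn, hn'⟩ y - z ⟨hz, -⟩
      exact ⟨n, hn.trans hz, hn'⟩)
    (by
      rintro x ⟨n, hn⟩
      refine ⟨n, ?_⟩
      filter_upwards [(isOpen_lt (hI.comp (hT.iterate n)) continuous_const).mem_nhds hn] with y hy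
      exact ⟨n, le_rfl, hy⟩) 1 (by norm_num)
    (by
      rintro x _ s ⟨n, hn, hn'⟩
      exact ⟨n, by simpa using hn, by rwa [iterate_odd T hodd, heven]⟩)
  refine ⟨fun x => interpIter T ⌈τ x⌉₊ (τ x) x, ?_, ?_, ?_⟩
  · intro x hx
    apply ContinuousAt.continuousWithinAt
    have hτx : ContinuousAt τ x := hτc.continuousAt (hPo.mem_nhds hx)
    obtain ⟨M, hM⟩ := exists_nat_gt (τ x)
    have h1 : ContinuousAt (fun y => interpIter T M (τ y) y) x :=
      ContinuousAt.comp (f := fun y => (τ y, y)) (g := fun p : ℝ × E => interpIter T M p.1 p.2)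
        (hGc M).continuousAt (hτx.prodMk continuousAt_id)
    refine h1.congr ?_
    filter_upwards [hτx.eventually (gt_mem_nhds hM)] with y hy
    exact hGconst _ _ _ _ (Nat.le_ceil _) (Nat.ceil_le.2 hy.le)
  · intro x
    simp only [hτe, one_smul, hGodd]
  · intro x hx
    obtain ⟨n, hn, hn'⟩ := hτS x hx
    refine (hGdec n _ _ _ (by exact_mod_cast hn.trans (Nat.le_ceil _))).trans_lt ?_
    rwa [hGiter n _ _ hn]

/-- Away from critical points near a critical level the derivative is bounded below. -/
lemma annulus {E : Type*} [NormedAddCommGroup E] [NormedSpace ℝ E]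
    (I : E → ℝ) (I' : E → (E →L[ℝ] ℝ)) (hI : Continuous I) (hcont : Continuous I')
    (hPS : ∀ (c : ℝ) (U : ℕ → E),
      Tendsto (fun j => I (U j)) atTop (nhds c) →
      Tendsto (fun j => ‖I' (U j)‖) atTop (nhds 0) →
      ∃ (u : E) (ψ : ℕ → ℕ), StrictMono ψ ∧ Tendsto (fun j => U (ψ j)) atTop (nhds u))
    (R : Set E) (hR : IsClosed R) (c : ℝ) (hno : ∀ u ∈ R, I u = c → I' u ≠ 0) :
    ∃ ε > 0, ∀ x ∈ R, |I x - c| ≤ ε → ε ≤ ‖I' x‖ := by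
  by_contra! hcon
  choose U hUR hUc hU' using fun n : ℕ => hcon (1 / ((n : ℝ) + 1)) (by positivity)
  have hz : Tendsto (fun n : ℕ => 1 / ((n : ℝ) + 1)) atTop (𝓝 0) :=
    tendsto_one_div_add_atTop_nhds_zero_nat
  have h1 : Tendsto (fun n => I (U n)) atTop (𝓝 c) := by
    rw [tendsto_iff_norm_sub_tendsto_zero]
    exact squeeze_zero (fun _ => norm_nonneg _) hUc hz
  have h2 : Tendsto (fun n => ‖I' (U n)‖) atTop (𝓝 0) :=
    squeeze_zero (fun _ => norm_nonneg _) (fun n => (hU' n).le) hz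
  obtain ⟨u, ψ, hψ, hu⟩ := hPS c U h1 h2
  refine hno u (hR.mem_of_tendsto hu (Eventually.of_forall fun n => hUR _)) ?_ ?_
  · exact tendsto_nhds_unique ((hI.tendsto u).comp hu) (h1.comp hψ.tendsto_atTop)
  · have h3 : Tendsto (fun n => ‖I' (U (ψ n))‖) atTop (𝓝 ‖I' u‖) :=
      (hcont.norm.tendsto u).comp hu
    exact norm_eq_zero.1 (tendsto_nhds_unique h3 (h2.comp hψ.tendsto_atTop))

/-- An orbit starting near `p` cannot leave it while keeping its energy near `I p`. -/
lemma crossing {E : Type*} [NormedAddCommGroup E] [NormedSpace ℝ E]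
    (I : E → ℝ) (I' : E → (E →L[ℝ] ℝ)) (T : E → E) (ρ : ℝ) (hρ : 0 < ρ)
    (hstep : ∀ u, ‖T u - u‖ ≤ ρ)
    (hdec : ∀ u, I (T u) ≤ I u - 1/4 * ‖I' u‖ * ‖T u - u‖)
    (p : E) (ε : ℝ) (hε : 0 < ε)
    (han : ∀ x, ρ ≤ ‖x - p‖ → ‖x - p‖ ≤ 4 * ρ → |I x - I p| ≤ ε → ε ≤ ‖I' x‖)
    (η : ℝ) (hη1 : η ≤ ε) (hη2 : 8 * η ≤ ε * ρ) (x : E)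
    (hx : ‖x - p‖ < ρ) (hxI : |I x - I p| < η) (n : ℕ) (hn : |I (T^[n] x) - I p| < η) :
    ‖T^[n] x - p‖ < 3 * ρ := by
  have hmono : ∀ k l, k ≤ l → I (T^[l] x) ≤ I (T^[k] x) := by
    intro k l hkl
    induction l, hkl using Nat.le_induction with
    | base => exact le_rfl
    | succ l _ ih =>
      rw [Function.iterate_succ_apply']
      have : 0 ≤ 1/4 * ‖I' (T^[l] x)‖ * ‖T (T^[l] x) - T^[l] x‖ := by positivity
      linarith [hdec (T^[l] x)]
  let φ : E → ℝ := fun y => max (2 * ρ) (min (3 * ρ) ‖y - p‖)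
  have key : ∀ k ≤ n, ε / 4 * (φ (T^[k] x) - φ x) ≤ I x - I (T^[k] x) := by
    intro k
    induction k with
    | zero => intro _; simp
    | succ k ih =>
      intro hk
      have ih := ih (by omega)
      rw [Function.iterate_succ_apply']
      set y := T^[k] x with hy
      have hyI : |I y - I p| ≤ ε := by
        have h1 := hmono k n (by omega)
        have h2 := hmono 0 k (by omega)
        rw [abs_lt] at hn hxI
        simp only [Function.iterate_zero, id] at h2
        rw [abs_le]; constructor <;> linarith
      have hd := hdec y
      have hs := hstep y
      have hnn : 0 ≤ 1/4 * ‖I' y‖ * ‖T y - y‖ := by positivity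
      have htri : ‖T y - p‖ ≤ ‖y - p‖ + ‖T y - y‖ := by
        calc ‖T y - p‖ = ‖(y - p) + (T y - y)‖ := by congr 1; abel
          _ ≤ _ := norm_add_le _ _
      have htri2 : ‖y - p‖ ≤ ‖T y - p‖ + ‖T y - y‖ := by
        calc ‖y - p‖ = ‖(T y - p) - (T y - y)‖ := by congr 1; abel
          _ ≤ _ := norm_sub_le _ _
      suffices h : ε / 4 * (φ (T y) - φ y) ≤ I y - I (T y) by linarith
      by_cases h1 : ‖y - p‖ < ρ
      · have e1 : φ y = 2 * ρ := max_eq_left ((min_le_right _ _).trans (by linarith))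
        have e2 : φ (T y) = 2 * ρ := max_eq_left ((min_le_right _ _).trans (by linarith))
        rw [e1, e2]; linarith
      by_cases h2 : 4 * ρ < ‖y - p‖
      · have e1 : φ y = 3 * ρ := by
          simp only [φ]; rw [min_eq_left (by linarith), max_eq_right (by linarith)]
        have e2 : φ (T y) = 3 * ρ := by
          simp only [φ]; rw [min_eq_left (by linarith), max_eq_right (by linarith)]
        rw [e1, e2]; linarith
      push Not at h1 h2
      have hge := han y h1 h2 hyI
      have hφ : φ (T y) - φ y ≤ ‖T y - y‖ := by
        have : φ (T y) ≤ φ y + ‖T y - y‖ := by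
          have hnn' := norm_nonneg (T y - y)
          refine max_le (le_add_of_le_of_nonneg (le_max_left _ _) hnn') ?_
          rcases le_total (3 * ρ) ‖y - p‖ with h | h
          · have : 3 * ρ ≤ φ y := (le_min le_rfl h).trans (le_max_right _ _)
            exact (min_le_left _ _).trans (by linarith)
          · have : ‖y - p‖ ≤ φ y := (le_min h le_rfl).trans (le_max_right _ _)
            exact (min_le_right _ _).trans (by linarith)
        linarith
      calc ε / 4 * (φ (T y) - φ y) ≤ ε / 4 * ‖T y - y‖ :=
            mul_le_mul_of_nonneg_left hφ (by positivity)
        _ ≤ ‖I' y‖ / 4 * ‖T y - y‖ := by gcongr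
        _ ≤ _ := by linarith
  by_contra! hcon
  have hk := key n le_rfl
  have e1 : φ x = 2 * ρ := max_eq_left ((min_le_right _ _).trans (by linarith))
  have e2 : φ (T^[n] x) = 3 * ρ := by
    simp only [φ]; rw [min_eq_left hcon, max_eq_right (by linarith)]
  rw [e1, e2] at hk
  rw [abs_lt] at hn hxI
  nlinarith

/-- Each orbit bounded below in energy accumulates at a critical point. -/
lemma orbit_acc {E : Type*} [NormedAddCommGroup E] [NormedSpace ℝ E] [CompleteSpace E]
    (I : E → ℝ) (I' : E → (E →L[ℝ] ℝ)) (hI : Continuous I) (hcont : Continuous I')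
    (hPS : ∀ (c : ℝ) (U : ℕ → E),
      Tendsto (fun j => I (U j)) atTop (nhds c) →
      Tendsto (fun j => ‖I' (U j)‖) atTop (nhds 0) →
      ∃ (u : E) (ψ : ℕ → ℕ), StrictMono ψ ∧ Tendsto (fun j => U (ψ j)) atTop (nhds u))
    (T : E → E) (hT : Continuous T)
    (hdec : ∀ u, I (T u) ≤ I u - 1/4 * ‖I' u‖ * ‖T u - u‖)
    (hfix : ∀ u, T u = u → I' u = 0)
    (b : ℝ) (x : E) (hx : ∀ n, b ≤ I (T^[n] x)) :
    ∃ u, I' u = 0 ∧ I u ≤ I x ∧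
      ∃ ψ : ℕ → ℕ, Tendsto (fun n => T^[ψ n] x) atTop (𝓝 u) := by
  have hanti : Antitone fun n => I (T^[n] x) := by
    refine antitone_nat_of_succ_le fun l => ?_
    rw [Function.iterate_succ_apply']
    have : 0 ≤ 1/4 * ‖I' (T^[l] x)‖ * ‖T (T^[l] x) - T^[l] x‖ := by positivity
    linarith [hdec (T^[l] x)]
  have hbdd : BddBelow (Set.range fun n => I (T^[n] x)) := ⟨b, by rintro _ ⟨n, rfl⟩; exact hx n⟩
  have hlim := tendsto_atTop_ciInf hanti hbdd
  set c := ⨅ n, I (T^[n] x)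
  have hIle : ∀ (u : E) (ψ : ℕ → ℕ), Tendsto (fun n => T^[ψ n] x) atTop (𝓝 u) → I u ≤ I x := by
    intro u ψ hu
    exact le_of_tendsto ((hI.tendsto u).comp hu)
      (Eventually.of_forall fun n => hanti (Nat.zero_le (ψ n)))
  by_cases hcase : ∀ σ > 0, ∃ᶠ n in atTop, ‖I' (T^[n] x)‖ < σ
  · have : ∃ φ : ℕ → ℕ, StrictMono φ ∧ ∀ n : ℕ, ‖I' (T^[φ n] x)‖ < 1 / ((n : ℝ) + 1) :=
      extraction_forall_of_frequently fun n => hcase _ (by positivity)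
    obtain ⟨φ, hφ, hφ'⟩ := this
    have h2 : Tendsto (fun n => ‖I' (T^[φ n] x)‖) atTop (𝓝 0) :=
      squeeze_zero (fun _ => norm_nonneg _) (fun n => (hφ' n).le)
        tendsto_one_div_add_atTop_nhds_zero_nat
    obtain ⟨u, ψ, hψ, hu⟩ := hPS c (fun n => T^[φ n] x) (hlim.comp hφ.tendsto_atTop) h2
    refine ⟨u, ?_, hIle u (fun n => φ (ψ n)) hu, fun n => φ (ψ n), hu⟩
    have h3 : Tendsto (fun n => ‖I' (T^[φ (ψ n)] x)‖) atTop (𝓝 ‖I' u‖) :=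
      (hcont.norm.tendsto u).comp hu
    exact norm_eq_zero.1 (tendsto_nhds_unique h3 (h2.comp hψ.tendsto_atTop))
  · push Not at hcase
    obtain ⟨σ, hσ, hev⟩ := hcase
    obtain ⟨N, hN⟩ := eventually_atTop.1 hev
    have hsum : Summable fun n => dist (T^[n + N] x) (T^[n.succ + N] x) := by
      refine summable_of_sum_range_le (c := 4 / σ * (I (T^[N] x) - b)) (fun _ => dist_nonneg) ?_
      intro n
      have hstep : ∀ i, dist (T^[i + N] x) (T^[i.succ + N] x) ≤
          4 / σ * (I (T^[i + N] x) - I (T^[i + 1 + N] x)) := by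
        intro i
        rw [show i.succ + N = (i + N) + 1 by omega,
          Function.iterate_succ_apply', dist_comm, dist_eq_norm]
        have h1 := hdec (T^[i + N] x)
        have h2 := hN (i + N) (by omega)
        set y := T^[i + N] x
        have h3 : σ * ‖T y - y‖ ≤ ‖I' y‖ * ‖T y - y‖ := by gcongr
        rw [div_mul_eq_mul_div, le_div_iff₀ hσ]
        linarith
      refine (Finset.sum_le_sum fun i _ => hstep i).trans ?_
      rw [← Finset.mul_sum, Finset.sum_range_sub' (fun i => I (T^[i + N] x))]
      have := hx (n + N)
      rw [zero_add]
      gcongr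
    obtain ⟨u, hu⟩ := cauchySeq_tendsto_of_complete (cauchySeq_of_summable_dist hsum)
    refine ⟨u, hfix u ?_, hIle u (fun n => n + N) hu, fun n => n + N, hu⟩
    have h1 : Tendsto (fun n => T (T^[n + N] x)) atTop (𝓝 (T u)) := (hT.tendsto u).comp hu
    have h2 : Tendsto (fun n => T^[(n + 1) + N] x) atTop (𝓝 u) :=
      hu.comp (tendsto_add_atTop_nat 1)
    refine tendsto_nhds_unique h1 (h2.congr fun n => ?_)
    rw [show n + 1 + N = (n + N) + 1 by omega, Function.iterate_succ_apply']

lemma glue {E F : Type*} [NormedAddCommGroup E] [NormedAddCommGroup F] [NormedSpace ℝ F]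
    (O : Set E) (hO : IsOpen O) (f : E → F) (hf : ContinuousOn f O) (h1 : ∀ x ∈ O, ‖f x‖ ≤ 1) :
    Continuous fun x => Metric.infDist x Oᶜ • f x := by
  rw [continuous_iff_continuousAt]
  intro x
  by_cases hx : x ∈ O
  · exact (Metric.continuous_infDist_pt _).continuousAt.smul (hf.continuousAt (hO.mem_nhds hx))
  · have h0 : Metric.infDist x Oᶜ = 0 := Metric.infDist_zero_of_mem hx
    rw [ContinuousAt, h0, zero_smul]
    have hb : Tendsto (fun y => Metric.infDist y Oᶜ) (𝓝 x) (𝓝 0) := by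
      have := (Metric.continuous_infDist_pt Oᶜ).tendsto x
      rwa [h0] at this
    refine squeeze_zero_norm (fun y => ?_) hb
    by_cases hy : y ∈ O
    · rw [norm_smul, Real.norm_of_nonneg Metric.infDist_nonneg]
      exact mul_le_of_le_one_right Metric.infDist_nonneg (h1 y hy)
    · rw [Metric.infDist_zero_of_mem (show y ∈ Oᶜ from hy)]; simp

lemma infDist_even {E : Type*} [NormedAddCommGroup E] (O : Set E)
    (hO : ∀ x ∈ O, -x ∈ O) (x : E) : Metric.infDist (-x) Oᶜ = Metric.infDist x Oᶜ := by
  have him : (fun y : E => -y) '' Oᶜ = Oᶜ := by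
    ext y
    simp only [Set.mem_image, Set.mem_compl_iff]
    constructor
    · rintro ⟨z, hz, rfl⟩ h
      exact hz (by simpa using hO _ h)
    · intro hy
      exact ⟨-y, fun h => hy (by simpa using hO _ h), neg_neg y⟩
  have := Metric.infDist_image (Φ := fun y : E => -y) (x := x) (t := Oᶜ)
    (IsometryEquiv.neg E).isometry
  rw [him] at this
  exact this

/-- Rabinowitz, Theorem 1.9: let `E` be a real Banach space and
`I ∈ C¹(E,ℝ)` be even with `I 0 = 0`, satisfying the Palais–Smale condition at every
level. If (1) there is a closed subspace `Ẽ ⊆ E` of codimension `j` with `I ≥ b` on `Ẽ`,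
and (2) there is a closed symmetric set `A` with `0 ∉ A`, Krasnoselskii genus
`γ(A) = m > j` and `sup_A I < 0`, then `I` possesses at least `m − j` distinct pairs
`{u, −u}` of nontrivial critical points. -/
theorem statement19
    {E : Type*} [NormedAddCommGroup E] [NormedSpace ℝ E] [CompleteSpace E]
    (I : E → ℝ) (I' : E → (E →L[ℝ] ℝ))
    (hderiv : ∀ u : E, HasFDerivAt I (I' u) u)
    (hcont : Continuous I')
    (heven : ∀ u : E, I (-u) = I u)
    (hzero : I 0 = 0)
    (hPS : ∀ (c : ℝ) (U : ℕ → E),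
      Tendsto (fun j => I (U j)) atTop (nhds c) →
      Tendsto (fun j => ‖I' (U j)‖) atTop (nhds 0) →
      ∃ (u : E) (ψ : ℕ → ℕ), StrictMono ψ ∧ Tendsto (fun j => U (ψ j)) atTop (nhds u))
    (j : ℕ) (Et : Submodule ℝ E) (hEtclosed : IsClosed (Et : Set E))
    (hcodim : ∃ W : Submodule ℝ E, FiniteDimensional ℝ W ∧
      Module.finrank ℝ W = j ∧ IsCompl W Et)
    (b : ℝ) (hb : ∀ u ∈ Et, b ≤ I u)
    (m : ℕ) (hmj : j < m)
    (A : Set E) (hAclosed : IsClosed A) (hAsym : ∀ u ∈ A, -u ∈ A) (hA0 : (0 : E) ∉ A)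
    (hgenus : GenusEq A m)
    (hsup : ∃ a : ℝ, a < 0 ∧ ∀ u ∈ A, I u ≤ a) :
    ∃ v : Fin (m - j) → E,
      (∀ i, v i ≠ 0 ∧ I' (v i) = 0) ∧
      ∀ i i', i ≠ i' → v i ≠ v i' ∧ v i ≠ - v i' := by
  obtain ⟨a, ha0, haA⟩ := hsup
  obtain ⟨W, hWfin, hWrank, hWE⟩ := hcodim
  have hI : Continuous I := continuous_iff_continuousAt.2 fun u => (hderiv u).continuousAt
  have hodd : ∀ u, I' (-u) = - I' u := by
    intro u
    have h1 : HasFDerivAt (fun x => I (-x)) ((I' (-u)).comp (-ContinuousLinearMap.id ℝ E)) u :=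
      (hderiv (-u)).comp u (hasFDerivAt_id u).neg
    have h2 : (fun x => I (-x)) = I := funext heven
    rw [h2] at h1
    have h3 := h1.unique (hderiv u)
    ext w
    have := DFunLike.congr_fun h3 w
    simp at this ⊢
    linarith
  have hself : ∀ u : E, u = -u → u = 0 := by
    intro u hu
    have h2 : (2 : ℝ) • u = 0 := by
      rw [two_smul]; nth_rewrite 2 [hu]; exact add_neg_cancel u
    exact (smul_eq_zero.1 h2).resolve_left two_ne_zero
  have hb0 : b ≤ 0 := by simpa [hzero] using hb 0 Et.zero_mem
  by_contra hcon
  let Q : ℕ → Prop := fun r => ∃ v : Fin r → E, (∀ i, I' (v i) = 0 ∧ I (v i) ≤ a) ∧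
    ∀ i i', i ≠ i' → v i ≠ v i' ∧ v i ≠ - v i'
  have hQ0 : Q 0 := ⟨Fin.elim0, fun i => i.elim0, fun i => i.elim0⟩
  have hQn : ¬ Q (m - j) := by
    rintro ⟨v, hv, hv'⟩
    refine hcon ⟨v, fun i => ⟨fun h => ?_, (hv i).1⟩, hv'⟩
    have := (hv i).2
    rw [h, hzero] at this
    linarith
  obtain ⟨r, hr, hQr, hQr1⟩ : ∃ r < m - j, Q r ∧ ¬ Q (r + 1) := by
    by_contra! hno
    have : ∀ n ≤ m - j, Q n := by
      intro n
      induction n with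
      | zero => intro _; exact hQ0
      | succ n ih => intro hn; exact hno n (by omega) (ih (by omega))
    exact hQn (this _ le_rfl)
  obtain ⟨v, hv, hv'⟩ := hQr
  have hall : ∀ u, I' u = 0 → I u ≤ a → ∃ i, u = v i ∨ u = - v i := by
    intro u hu hua
    by_contra! hne
    refine hQr1 ⟨Fin.cons u v, ?_, ?_⟩
    · intro i
      refine Fin.cases ?_ (fun i => ?_) i
      · exact ⟨hu, hua⟩
      · simpa using hv i
    · intro i i'
      refine Fin.cases ?_ (fun i => ?_) i <;> refine Fin.cases ?_ (fun i' => ?_) i'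
      · intro h; exact absurd rfl h
      · intro _; simpa using hne i'
      · intro _
        simp only [Fin.cons_succ, Fin.cons_zero]
        refine ⟨(hne i).1.symm, fun h => (hne i).2 ?_⟩
        rw [h, neg_neg]
      · intro h
        simpa using hv' i i' (fun h' => h (by rw [h']))
  have hv0 : ∀ i, v i ≠ 0 := fun i h => by
    have := (hv i).2
    rw [h, hzero] at this
    linarith
  -- the separation radius
  let K : Set E := Set.range v ∪ Set.range (fun i => - v i)
  have hKfin : K.Finite := (Set.finite_range _).union (Set.finite_range _)
  obtain ⟨ρ, hρ, hsep⟩ : ∃ ρ > 0, ∀ p ∈ K, ∀ q ∈ K, p ≠ q → 4 * ρ < dist p q := by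
    have : ∀ᶠ ρ : ℝ in 𝓝[>] 0, ∀ pq ∈ K ×ˢ K, pq.1 ≠ pq.2 → 4 * ρ < dist pq.1 pq.2 := by
      rw [(hKfin.prod hKfin).eventually_all]
      rintro ⟨p, q⟩ -
      by_cases hpq : p = q
      · simp [hpq]
      have hc : Continuous fun ρ : ℝ => 4 * ρ := by fun_prop
      have := hc.tendsto 0
      rw [mul_zero] at this
      filter_upwards [(this.eventually (gt_mem_nhds (dist_pos.2 hpq))).filter_mono
        nhdsWithin_le_nhds] with ρ hρ _
      exact hρ
    obtain ⟨ρ, h1, h2⟩ := (this.and self_mem_nhdsWithin).exists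
    exact ⟨ρ, h2, fun p hp q hq => h1 (p, q) ⟨hp, hq⟩⟩
  have hvK : ∀ i, v i ∈ K := fun i => Or.inl ⟨i, rfl⟩
  have hvK' : ∀ i, - v i ∈ K := fun i => Or.inr ⟨i, rfl⟩
  have hvρ : ∀ i, 2 * ρ < ‖v i‖ := by
    intro i
    have h1 : v i ≠ - v i := fun h => hv0 i (hself _ h)
    have h2 := hsep _ (hvK i) _ (hvK' i) h1
    rw [dist_eq_norm, sub_neg_eq_add, ← two_smul ℝ, norm_smul] at h2
    norm_num at h2
    linarith
  obtain ⟨T, hTc, hTodd, hTstep, hTdec, hTfix⟩ :=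
    step_map I I' hderiv hcont heven hodd ρ hρ
  have hTdec1 : ∀ u, I (T u) ≤ I u - 1/4 * ‖I' u‖ * ‖T u - u‖ := by
    intro u
    have := hTdec u 1 zero_le_one le_rfl
    rwa [one_smul, add_sub_cancel, one_mul] at this
  have hT0 : ∀ n, T^[n] (0 : E) = 0 := by
    intro n
    have := iterate_odd T hTodd n 0
    rw [neg_zero] at this
    exact hself _ this
  -- energy gaps
  have hgap : ∀ i, ∃ ε > 0, ∀ x, ρ ≤ ‖x - v i‖ → ‖x - v i‖ ≤ 4 * ρ →
      |I x - I (v i)| ≤ ε → ε ≤ ‖I' x‖ := by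
    intro i
    have hc : Continuous fun x => ‖x - v i‖ := by fun_prop
    obtain ⟨ε, hε, h⟩ := annulus I I' hI hcont hPS {x | ρ ≤ ‖x - v i‖ ∧ ‖x - v i‖ ≤ 4 * ρ}
      ((isClosed_le continuous_const hc).inter (isClosed_le hc continuous_const)) (I (v i)) (by
        rintro u ⟨hu1, hu2⟩ huI hu
        have huK : u ∈ K := by
          obtain ⟨k, rfl | rfl⟩ := hall u hu (huI ▸ (hv i).2)
          · exact hvK k
          · exact hvK' k
        have hne : u ≠ v i := fun h => by
          rw [h, sub_self, norm_zero] at hu1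
          linarith
        have := hsep u huK _ (hvK i) hne
        rw [dist_eq_norm] at this
        linarith)
    exact ⟨ε, hε, fun x h1 h2 => h x ⟨h1, h2⟩⟩
  choose ε hε hεan using hgap
  let η : Fin r → ℝ := fun i => min (ε i) (ε i * ρ / 8)
  have hη : ∀ i, 0 < η i := fun i => lt_min (hε i) (by have := hε i; positivity)
  have hη1 : ∀ i, η i ≤ ε i := fun i => min_le_left _ _
  have hη2 : ∀ i, 8 * η i ≤ ε i * ρ := fun i => by
    have : η i ≤ ε i * ρ / 8 := min_le_right _ _
    linarith
  let O : Fin r → Set E := fun i => {x | ‖x - v i‖ < ρ ∧ |I x - I (v i)| < η i}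
  have hOo : ∀ i, IsOpen (O i) := fun i => by
    have c1 : Continuous fun x => ‖x - v i‖ := by fun_prop
    have c2 : Continuous fun x => |I x - I (v i)| := by fun_prop
    exact (isOpen_lt c1 continuous_const).inter (isOpen_lt c2 continuous_const)
  let Qp : Fin r → Set E := fun i => {x | ∃ n, T^[n] x ∈ O i}
  have hQpo : ∀ i, IsOpen (Qp i) := fun i => by
    have : Qp i = ⋃ n, T^[n] ⁻¹' (O i) := by ext; simp [Qp]
    rw [this]
    exact isOpen_iUnion fun n => (hOo i).preimage (hTc.iterate n)
  let Qm : Fin r → Set E := fun i => {x | -x ∈ Qp i}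
  have hQmo : ∀ i, IsOpen (Qm i) := fun i => (hQpo i).preimage continuous_neg
  have hdisj0 : ∀ i x n k, n ≤ k → T^[n] x ∈ O i → T^[k] (-x) ∈ O i → False := by
    intro i x n k hnk h1 h2
    obtain ⟨l, rfl⟩ := Nat.exists_eq_add_of_le' hnk
    rw [iterate_odd T hTodd, Function.iterate_add_apply] at h2
    obtain ⟨h2a, h2b⟩ := h2
    rw [heven] at h2b
    have h3 := crossing I I' T ρ hρ hTstep hTdec1 (v i) (ε i) (hε i) (hεan i) (η i) (hη1 i)
      (hη2 i) (T^[n] x) h1.1 h1.2 l h2b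
    set z := T^[l] (T^[n] x)
    have h4 : ‖(2 : ℝ) • v i‖ ≤ ‖z - v i‖ + ‖-z - v i‖ := by
      calc ‖(2 : ℝ) • v i‖ = ‖(z - v i) + (-z - v i)‖ := by
            rw [← norm_neg]; congr 1; rw [two_smul]; abel
        _ ≤ _ := norm_add_le _ _
    rw [norm_smul] at h4
    norm_num at h4
    linarith [hvρ i]
  have hdisj : ∀ i x, x ∈ Qp i → -x ∈ Qp i → False := by
    rintro i x ⟨n, hn⟩ ⟨k, hk⟩
    rcases le_total n k with h | h
    · exact hdisj0 i x n k h hn hk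
    · exact hdisj0 i (-x) k n h hk (by rwa [neg_neg])
  let Qs : Fin r → Set E := fun i => Qp i ∪ Qm i
  have hQso : ∀ i, IsOpen (Qs i) := fun i => (hQpo i).union (hQmo i)
  have hQssym : ∀ i, ∀ x ∈ Qs i, -x ∈ Qs i := by
    rintro i x (hx | hx)
    · exact Or.inr (by simpa [Qm] using hx)
    · exact Or.inl hx
  have hQs0 : ∀ i, (0 : E) ∈ (Qs i)ᶜ := by
    intro i
    have : (0 : E) ∉ Qp i := by
      rintro ⟨n, hn, -⟩
      rw [hT0, zero_sub, norm_neg] at hn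
      linarith [hvρ i]
    rintro (h | h)
    · exact this h
    · exact this (by simpa [Qm] using h)
  classical
  let sg : Fin r → E → ℝ := fun i x => if x ∈ Qp i then 1 else -1
  have hsgc : ∀ i, ContinuousOn (sg i) (Qs i) := by
    rintro i x hx
    apply ContinuousAt.continuousWithinAt
    rcases hx with hx | hx
    · refine (continuousAt_const (y := (1 : ℝ))).congr ?_
      filter_upwards [(hQpo i).mem_nhds hx] with y hy
      simp [sg, hy]
    · refine (continuousAt_const (y := (-1 : ℝ))).congr ?_
      filter_upwards [(hQmo i).mem_nhds hx] with y hy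
      have : y ∉ Qp i := fun h => hdisj i y h hy
      simp [sg, this]
  have hsgodd : ∀ i, ∀ x ∈ Qs i, sg i (-x) = - sg i x := by
    rintro i x (hx | hx)
    · have : -x ∉ Qp i := fun h => hdisj i x hx h
      simp [sg, hx, this]
    · have h1 : -x ∈ Qp i := hx
      have h2 : x ∉ Qp i := fun h => hdisj i x h hx
      simp [sg, h1, h2]
  have hsg1 : ∀ i x, ‖sg i x‖ = 1 := by
    intro i x
    by_cases h : x ∈ Qp i <;> simp [sg, h]
  -- the part flowing below level `b`
  obtain ⟨h, hhc, hhodd, hhb⟩ := reach_map I hI heven T hTc hTodd (fun u θ h0 h1 => by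
    have h2 := hTdec u θ h0 h1
    have : 0 ≤ θ * (1/4 * ‖I' u‖ * ‖T u - u‖) := by positivity
    linarith) b
  set P : Set E := {x | ∃ n, I (T^[n] x) < b} with hP
  have hPo : IsOpen P := by
    have : P = ⋃ n, {x | I (T^[n] x) < b} := by ext; simp [P]
    rw [this]
    exact isOpen_iUnion fun n => isOpen_lt (hI.comp (hTc.iterate n)) continuous_const
  have hPsym : ∀ x ∈ P, -x ∈ P := fun x ⟨n, hn⟩ =>
    ⟨n, by rwa [iterate_odd T hTodd, heven]⟩
  have hP0 : (0 : E) ∈ Pᶜ := by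
    rintro ⟨n, hn⟩
    rw [hT0, hzero] at hn
    linarith
  have htop : Submodule.IsTopCompl W Et :=
    Submodule.IsCompl.isTopCompl_of_isClosed hWE W.closed_of_finiteDimensional hEtclosed
  let π : E →L[ℝ] W := Submodule.projectionOntoL W Et htop
  have hπ : ∀ x, π x = 0 → x ∈ Et := by
    intro x hx
    have : x ∈ (π : E →ₗ[ℝ] W).ker := hx
    rwa [Submodule.ker_projectionOntoL] at this
  have hπP : ∀ x ∈ P, π (h x) ≠ 0 := fun x hx h0 => by
    have h1 := hb _ (hπ _ h0)
    have h2 := hhb x hx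
    linarith
  let f : E → W := fun x => ‖π (h x)‖⁻¹ • π (h x)
  have hfc : ContinuousOn f P := by
    have h1 : ContinuousOn (fun x => π (h x)) P := π.continuous.comp_continuousOn hhc
    exact (h1.norm.inv₀ fun x hx => norm_ne_zero_iff.2 (hπP x hx)).smul h1
  have hf1 : ∀ x ∈ P, ‖f x‖ = 1 := fun x hx => by
    simp only [f]
    rw [norm_smul, norm_inv, norm_norm, inv_mul_cancel₀ (norm_ne_zero_iff.2 (hπP x hx))]
  have hfodd : ∀ x, f (-x) = - f x := fun x => by
    simp only [f, hhodd, map_neg, norm_neg, smul_neg]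
  -- the glued odd map
  let F : E → W × (Fin r → ℝ) := fun x =>
    (Metric.infDist x Pᶜ • f x, fun i => Metric.infDist x (Qs i)ᶜ • sg i x)
  have hFc : Continuous F := by
    refine Continuous.prodMk (glue P hPo f hfc fun x hx => (hf1 x hx).le) ?_
    exact continuous_pi fun i => glue (Qs i) (hQso i) (sg i) (hsgc i) fun x _ => (hsg1 i x).le
  have hFodd : ∀ x, F (-x) = - F x := by
    intro x
    refine Prod.ext ?_ ?_
    · simp only [F, Prod.fst_neg]
      rw [infDist_even P hPsym, hfodd, smul_neg]
    · ext i
      simp only [F, Prod.snd_neg, Pi.neg_apply]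
      rw [infDist_even (Qs i) (hQssym i)]
      by_cases hx : x ∈ Qs i
      · rw [hsgodd i x hx, smul_neg]
      · rw [Metric.infDist_zero_of_mem (show x ∈ (Qs i)ᶜ from hx)]; simp
  have hpos : ∀ (S : Set E), IsOpen S → (0 : E) ∈ Sᶜ → ∀ x ∈ S, Metric.infDist x Sᶜ ≠ 0 := by
    intro S hS h0 x hx
    exact ((hS.isClosed_compl.notMem_iff_infDist_pos ⟨0, h0⟩).1 (by simpa using hx)).ne'
  have hFne : ∀ x ∈ A, F x ≠ 0 := by
    intro x hx hF
    have hF1 : Metric.infDist x Pᶜ • f x = 0 := congrArg Prod.fst hF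
    have hF2 : ∀ i, Metric.infDist x (Qs i)ᶜ • sg i x = 0 := fun i =>
      congrFun (congrArg Prod.snd hF) i
    have hxP : x ∉ P := by
      intro hxP
      rcases smul_eq_zero.1 hF1 with h1 | h1
      · exact hpos P hPo hP0 x hxP h1
      · have := hf1 x hxP
        rw [h1, norm_zero] at this
        exact zero_ne_one this
    have hxQ : ∀ i, x ∉ Qs i := by
      intro i hxQ
      rcases smul_eq_zero.1 (hF2 i) with h1 | h1
      · exact hpos (Qs i) (hQso i) (hQs0 i) x hxQ h1
      · have := hsg1 i x
        rw [h1, norm_zero] at this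
        exact zero_ne_one this
    have hbd : ∀ n, b ≤ I (T^[n] x) := by
      intro n
      by_contra! hlt
      exact hxP ⟨n, hlt⟩
    obtain ⟨u, hu, huI, ψ, hψ⟩ :=
      orbit_acc I I' hI hcont hPS T hTc hTdec1 hTfix b x hbd
    obtain ⟨i, hi⟩ := hall u hu (huI.trans (haA x hx))
    have hvO : v i ∈ O i := ⟨by simpa using hρ, by simpa using hη i⟩
    rcases hi with rfl | rfl
    · obtain ⟨n, hn⟩ := (hψ.eventually ((hOo i).mem_nhds hvO)).exists
      exact hxQ i (Or.inl ⟨ψ n, hn⟩)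
    · have h1 := hψ.neg
      rw [neg_neg] at h1
      obtain ⟨n, hn⟩ := (h1.eventually ((hOo i).mem_nhds hvO)).exists
      exact hxQ i (Or.inr ⟨ψ n, by rwa [iterate_odd T hTodd]⟩)
  have hrank : Module.finrank ℝ (W × (Fin r → ℝ)) =
      Module.finrank ℝ (EuclideanSpace ℝ (Fin (j + r))) := by
    rw [Module.finrank_prod, hWrank, finrank_euclideanSpace_fin, Module.finrank_fin_fun]
  let L := ContinuousLinearEquiv.ofFinrankEq hrank
  have hG : GenusLE A (j + r) :=
    ⟨fun x => L (F x), (L.continuous.comp hFc).continuousOn,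
      fun x _ => by simp only [hFodd, map_neg],
      fun x hx h0 => hFne x hx (L.map_eq_zero_iff.1 h0)⟩
  have := hgenus.2 _ hG
  omega
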